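/- arXiv:2505.09332 — 4 statements merged into one kernel-verified Lean document; each statement's English description precedes it below -/
import Mathlib

section
/- The presented group on three generators x₁, x₂, x₃ with relators x₁^2, x₁*x₂*x₁*x₂*x₁⁻¹*x₂⁻¹ and x₂*x₃*x₂*x₃*x₂⁻¹*x₃⁻¹ is isomorphic to the Coxeter group W(3,3,∞), i.e. to the presented group on three generators x₁, x₂, x₃ with relators x₁^2, x₂^2, x₃^2, (x₁*x₂)^3 and (x₂*x₃)^3. -/
/-- The generator `x₁` of the free group on three generators. -/
def x1 : FreeGroup (Fin 3) := FreeGroup.of 0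

/-- The generator `x₂` of the free group on three generators. -/
def x2 : FreeGroup (Fin 3) := FreeGroup.of 1

/-- The generator `x₃` of the free group on three generators. -/
def x3 : FreeGroup (Fin 3) := FreeGroup.of 2

/-- The relators of the Coxeter group `W(3,3,∞)`:
`x₁², x₂², x₃², (x₁x₂)³, (x₂x₃)³`. -/
def W33InfRels : Set (FreeGroup (Fin 3)) :=
  {x1 ^ 2, x2 ^ 2, x3 ^ 2, (x1 * x2) ^ 3, (x2 * x3) ^ 3}

/-- The τ-presentation relators `x₁²`, `x₁x₂x₁x₂x₁⁻¹x₂⁻¹` and `x₂x₃x₂x₃x₂⁻¹x₃⁻¹`. -/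
def rels7 : Set (FreeGroup (Fin 3)) :=
  {x1 ^ 2, x1 * x2 * x1 * x2 * x1⁻¹ * x2⁻¹, x2 * x3 * x2 * x3 * x2⁻¹ * x3⁻¹}

/-- The relator `ababa⁻¹b⁻¹` says that `a` is conjugate to `b⁻¹` by `ba`; so if `a` is an
involution, it amounts to `b` being an involution with `(ab)³ = 1`. -/
theorem tau_relation_iff_of_sq_eq_one {G : Type*} [Group G] {a b : G} (ha : a ^ 2 = 1) :
    a * b * a * b * a⁻¹ * b⁻¹ = 1 ↔ b ^ 2 = 1 ∧ (a * b) ^ 3 = 1 := by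
  have ha' : a⁻¹ = a := inv_eq_of_mul_eq_one_left (by rw [← sq, ha])
  have cube_eq (hb : b ^ 2 = 1) : (a * b) ^ 3 = a * b * a * b * a⁻¹ * b⁻¹ := by
    have hb' : b⁻¹ = b := inv_eq_of_mul_eq_one_left (by rw [← sq, hb])
    rw [ha', hb']
    simp only [pow_succ, pow_zero, one_mul, mul_assoc]
  refine ⟨fun h => ?_, fun ⟨hb, h⟩ => (cube_eq hb).symm.trans h⟩
  have hb : b ^ 2 = 1 := by
    have hconj : a⁻¹ = (b * a) * b * (b * a)⁻¹ := by
      rw [inv_eq_iff_mul_eq_one, ← h]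
      group
    have hsq : (b * a) * b ^ 2 * (b * a)⁻¹ = 1 := by
      rw [← conj_pow, ← hconj, inv_pow, ha, inv_one]
    exact conj_eq_one_iff.mp hsq
  exact ⟨hb, (cube_eq hb).trans h⟩

theorem rels7_subset_iff (N : Subgroup (FreeGroup (Fin 3))) [N.Normal] :
    rels7 ⊆ (N : Set (FreeGroup (Fin 3))) ↔ W33InfRels ⊆ (N : Set (FreeGroup (Fin 3))) := by
  simp only [rels7, W33InfRels, Set.insert_subset_iff, Set.singleton_subset_iff,
    SetLike.mem_coe, ← QuotientGroup.eq_one_iff, QuotientGroup.mk_mul, QuotientGroup.mk_pow,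
    QuotientGroup.mk_inv]
  constructor
  · rintro ⟨h₁, h₁₂, h₂₃⟩
    obtain ⟨h₂, h₁₂'⟩ := (tau_relation_iff_of_sq_eq_one h₁).mp h₁₂
    obtain ⟨h₃, h₂₃'⟩ := (tau_relation_iff_of_sq_eq_one h₂).mp h₂₃
    exact ⟨h₁, h₂, h₃, h₁₂', h₂₃'⟩
  · rintro ⟨h₁, h₂, h₃, h₁₂, h₂₃⟩
    exact ⟨h₁, (tau_relation_iff_of_sq_eq_one h₁).mpr ⟨h₂, h₁₂⟩,
      (tau_relation_iff_of_sq_eq_one h₂).mpr ⟨h₃, h₂₃⟩⟩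

theorem normalClosure_rels7 :
    Subgroup.normalClosure rels7 = Subgroup.normalClosure W33InfRels :=
  le_antisymm
    (Subgroup.normalClosure_le_normal
      ((rels7_subset_iff _).mpr Subgroup.subset_normalClosure))
    (Subgroup.normalClosure_le_normal
      ((rels7_subset_iff _).mp Subgroup.subset_normalClosure))

/-- The presented group
`⟨x₁, x₂, x₃ ∣ x₁² = 1, x₁x₂x₁x₂x₁⁻¹x₂⁻¹ = 1, x₂x₃x₂x₃x₂⁻¹x₃⁻¹ = 1⟩` is isomorphic to
the Coxeter group `W(3,3,∞)`. -/
theorem stmt_7 : Nonempty (PresentedGroup rels7 ≃* PresentedGroup W33InfRels) :=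
  ⟨QuotientGroup.quotientMulEquivOfEq normalClosure_rels7⟩
end

section
/- The presented group on three generators x₁, x₂, x₃ with relators x₁^2, x₁*w₁*x₃*w₁⁻¹ where w₁ = x₂*x₁⁻¹*x₂*x₃⁻¹*x₂⁻¹, and x₂*w₂*x₃*w₂⁻¹ where w₂ = x₃*x₂⁻¹*x₁*x₂⁻¹*x₁⁻¹*x₂*x₁⁻¹*x₂, is isomorphic to the Coxeter group W(3,3,∞), i.e. to the presented group on generators x₁, x₂, x₃ with relators x₁^2, x₂^2, x₃^2, (x₁*x₂)^3, (x₂*x₃)^3. (This is the fundamental group computation for the Price twist τ_{R(D(12n₅₅₃))} in Proposition 4.17 and Remark 4.18.) -/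
/-- The word `w₁ = x₂x₁⁻¹x₂x₃⁻¹x₂⁻¹`. -/
def w1 : FreeGroup (Fin 3) := x2 * x1⁻¹ * x2 * x3⁻¹ * x2⁻¹

/-- The word `w₂ = x₃x₂⁻¹x₁x₂⁻¹x₁⁻¹x₂x₁⁻¹x₂`. -/
def w2 : FreeGroup (Fin 3) := x3 * x2⁻¹ * x1 * x2⁻¹ * x1⁻¹ * x2 * x1⁻¹ * x2

/-- The τ-presentation relators of `π₁(τ_{R(D(12n₅₅₃))})`. -/
def rels8 : Set (FreeGroup (Fin 3)) :=
  {x1 ^ 2, x1 * w1 * x3 * w1⁻¹, x2 * w2 * x3 * w2⁻¹}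

theorem sq_eq_one_of_mul_conj_eq_one {G : Type*} [Group G] {a c w : G}
    (h : a * w * c * w⁻¹ = 1) : a ^ 2 = 1 ↔ c ^ 2 = 1 := by
  have ha : a = w * c⁻¹ * w⁻¹ := by
    rw [← mul_inv_eq_one, ← h]
    group
  rw [ha, conj_pow, conj_eq_one_iff, inv_pow, inv_eq_one]

/-- For involutions `a`, `b`, `c`, the relators `x₁w₁x₃w₁⁻¹` and `x₂w₂x₃w₂⁻¹` both vanish exactly
when `(ab)³ = (bc)³ = 1`. -/
theorem conj_relations_iff {G : Type*} [Group G] {a b c : G}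
    (ha : a⁻¹ = a) (hb : b⁻¹ = b) (hc : c⁻¹ = c) :
    (a * (b * a⁻¹ * b * c⁻¹ * b⁻¹) * c * (b * a⁻¹ * b * c⁻¹ * b⁻¹)⁻¹ = 1 ∧
      b * (c * b⁻¹ * a * b⁻¹ * a⁻¹ * b * a⁻¹ * b) * c *
        (c * b⁻¹ * a * b⁻¹ * a⁻¹ * b * a⁻¹ * b)⁻¹ = 1) ↔
    (a * b) ^ 3 = 1 ∧ (b * c) ^ 3 = 1 := by
  have haa : a * a = 1 := by rw [← inv_eq_iff_mul_eq_one, ha]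
  have hbb : b * b = 1 := by rw [← inv_eq_iff_mul_eq_one, hb]
  have hcc : c * c = 1 := by rw [← inv_eq_iff_mul_eq_one, hc]
  have haa' (g : G) : a * (a * g) = g := by rw [← mul_assoc, haa, one_mul]
  have hbb' (g : G) : b * (b * g) = g := by rw [← mul_assoc, hbb, one_mul]
  have hcc' (g : G) : c * (c * g) = g := by rw [← mul_assoc, hcc, one_mul]
  have first : a * (b * a⁻¹ * b * c⁻¹ * b⁻¹) * c * (b * a⁻¹ * b * c⁻¹ * b⁻¹)⁻¹ =
      (b * a * b) * ((b * a) ^ 3 * (b * c) ^ 3) * (b * a * b)⁻¹ := by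
    simp only [pow_succ, pow_zero, one_mul, mul_inv_rev, ha, hb, hc, mul_assoc, haa', hbb']
  have second : b * (c * b⁻¹ * a * b⁻¹ * a⁻¹ * b * a⁻¹ * b) * c *
        (c * b⁻¹ * a * b⁻¹ * a⁻¹ * b * a⁻¹ * b)⁻¹ =
      b * c * (b * a) ^ 3 * (b * c * b) * (a * b) ^ 3 * c := by
    simp only [pow_succ, pow_zero, one_mul, mul_inv_rev, ha, hb, hc, mul_assoc]
  have hba : (b * a) ^ 3 = ((a * b) ^ 3)⁻¹ := by rw [← inv_pow, mul_inv_rev, ha, hb]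
  rw [first, second, conj_eq_one_iff, hba, inv_mul_eq_one]
  constructor
  · rintro ⟨h, h'⟩
    have h3 : (b * c) ^ 3 = 1 := by
      rw [h] at h'
      have : b * c * ((b * c) ^ 3)⁻¹ * (b * c * b) * (b * c) ^ 3 * c = ((b * c) ^ 3)⁻¹ := by
        simp only [pow_succ, pow_zero, one_mul, mul_inv_rev, hb, hc, mul_assoc, hbb', hcc',
          hcc, mul_one]
      rwa [this, inv_eq_one] at h'
    exact ⟨h.trans h3, h3⟩
  · rintro ⟨h, h'⟩
    refine ⟨h.trans h'.symm, ?_⟩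
    simpa [h, pow_succ, mul_assoc] using h'

/-- The two sets of relations are equivalent in every group. -/
theorem relations_iff {G : Type*} [Group G] (f : FreeGroup (Fin 3) →* G) :
    (∀ r ∈ rels8, f r = 1) ↔ ∀ r ∈ W33InfRels, f r = 1 := by
  simp only [rels8, W33InfRels, w1, w2, Set.mem_insert_iff, Set.mem_singleton_iff,
    forall_eq_or_imp, forall_eq, map_mul, map_inv, map_pow]
  have inv_self {g : G} (h : g ^ 2 = 1) : g⁻¹ = g := by
    rwa [inv_eq_iff_mul_eq_one, ← sq]
  constructor
  · rintro ⟨ha, h, h'⟩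
    have hc := (sq_eq_one_of_mul_conj_eq_one h).1 ha
    have hb := (sq_eq_one_of_mul_conj_eq_one h').2 hc
    exact ⟨ha, hb, hc, (conj_relations_iff (inv_self ha) (inv_self hb) (inv_self hc)).1 ⟨h, h'⟩⟩
  · rintro ⟨ha, hb, hc, h⟩
    exact ⟨ha, (conj_relations_iff (inv_self ha) (inv_self hb) (inv_self hc)).2 h⟩

theorem normalClosure_rels8 :
    Subgroup.normalClosure rels8 = Subgroup.normalClosure W33InfRels := by
  apply le_antisymm <;> refine Subgroup.normalClosure_le_normal fun r hr => ?_
  · exact PresentedGroup.mk_eq_one_iff.1 <|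
      (relations_iff (PresentedGroup.mk W33InfRels)).2
        (fun _ => PresentedGroup.one_of_mem) r hr
  · exact PresentedGroup.mk_eq_one_iff.1 <|
      (relations_iff (PresentedGroup.mk rels8)).1 (fun _ => PresentedGroup.one_of_mem) r hr

/-- The fundamental group of the Price twist `τ_{R(D(12n₅₅₃))}`, presented as
`⟨x₁, x₂, x₃ ∣ x₁² = 1, x₁w₁x₃w₁⁻¹ = 1, x₂w₂x₃w₂⁻¹ = 1⟩`, is isomorphic to the Coxeter
group `W(3,3,∞)`. -/
theorem stmt_8 : Nonempty (PresentedGroup rels8 ≃* PresentedGroup W33InfRels) := by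
  exact ⟨QuotientGroup.quotientMulEquivOfEq normalClosure_rels8⟩
end

section
/- The presented group on three generators x₁, x₂, x₃ with relators x₁^2, x₁*u*x₃*u⁻¹ where u = x₂⁻¹*x₁⁻¹*x₃*x₂, and x₂*v*x₃*v⁻¹ where v = x₃⁻¹*x₁*x₂*x₁*x₂⁻¹*x₁⁻¹, is isomorphic to the Coxeter group W(3,3,∞), i.e. to the presented group on generators x₁, x₂, x₃ with relators x₁^2, x₂^2, x₃^2, (x₁*x₂)^3, (x₂*x₃)^3. (This is the fundamental group computation for τ_{R(D(3₁#6₁#3₁*))} in Proposition 4.17 and Remark 4.18.) -/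
/-- The word `u = x₂⁻¹x₁⁻¹x₃x₂`. -/
def u : FreeGroup (Fin 3) := x2⁻¹ * x1⁻¹ * x3 * x2

/-- The word `v = x₃⁻¹x₁x₂x₁x₂⁻¹x₁⁻¹`. -/
def v : FreeGroup (Fin 3) := x3⁻¹ * x1 * x2 * x1 * x2⁻¹ * x1⁻¹

/-- The τ-presentation relators of `π₁(τ_{R(D(3₁#6₁#3₁*))})`. -/
def rels10 : Set (FreeGroup (Fin 3)) :=
  {x1 ^ 2, x1 * u * x3 * u⁻¹, x2 * v * x3 * v⁻¹}

/-- Presentations on the same generators whose relators are trivial in each other's group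
define isomorphic groups. -/
theorem PresentedGroup.nonempty_mulEquiv_of_mk_eq_one {α : Type*} {R S : Set (FreeGroup α)}
    (hR : ∀ r ∈ R, PresentedGroup.mk S r = 1) (hS : ∀ s ∈ S, PresentedGroup.mk R s = 1) :
    Nonempty (PresentedGroup R ≃* PresentedGroup S) :=
  ⟨QuotientGroup.quotientMulEquivOfEq <| le_antisymm
    (Subgroup.normalClosure_le_normal fun r hr => (QuotientGroup.eq_one_iff r).1 (hR r hr))
    (Subgroup.normalClosure_le_normal fun s hs => (QuotientGroup.eq_one_iff s).1 (hS s hs))⟩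

section

variable {G : Type*} [Group G] {a b c : G}

theorem inv_eq_self_of_sq_eq_one (h : a ^ 2 = 1) : a⁻¹ = a :=
  inv_eq_of_mul_eq_one_left (by rw [← sq, h])

/-- If `a * (g * b * g⁻¹) = 1`, then `a` is an involution if and only if `b` is. -/
theorem sq_eq_one_iff_of_mul_conj_eq_one {g : G} (h : a * g * b * g⁻¹ = 1) :
    a ^ 2 = 1 ↔ b ^ 2 = 1 := by
  have ha : a = g * b⁻¹ * g⁻¹ := by
    calc a = a * g * b * g⁻¹ * (g * b⁻¹ * g⁻¹) := by group
      _ = g * b⁻¹ * g⁻¹ := by rw [h, one_mul]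
  rw [ha, conj_pow, conj_eq_one_iff, inv_pow, inv_eq_one]

/-- If `b` is an involution, then `(a * b) ^ 3 = 1` says that `a b a b a` equals `b`. -/
theorem mul_pow_three_eq_one_iff (hb : b ^ 2 = 1) :
    (a * b) ^ 3 = 1 ↔ a * b * a * b * a = b := by
  rw [show (a * b) ^ 3 = a * b * a * b * a * b by
    simp only [pow_succ, pow_zero, one_mul, mul_assoc], mul_eq_one_iff_eq_inv,
    inv_eq_self_of_sq_eq_one hb]

/-- For involutions, the relation `a = u c u⁻¹` with `u = b a c b` says `ababa = cbcbc`. -/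
theorem conj_relation_iff (ha : a ^ 2 = 1) (hb : b ^ 2 = 1) (hc : c ^ 2 = 1) :
    a * (b⁻¹ * a⁻¹ * c * b) * c * (b⁻¹ * a⁻¹ * c * b)⁻¹ = 1 ↔
      a * b * a * b * a = c * b * c * b * c := by
  have ha' := inv_eq_self_of_sq_eq_one ha
  have hb' := inv_eq_self_of_sq_eq_one hb
  have hc' := inv_eq_self_of_sq_eq_one hc
  have hinv : (c * b * c * b * c)⁻¹ = c * b * c * b * c := by
    simp only [mul_inv_rev, hb', hc', mul_assoc]
  have hconj : a * b * (a * (b⁻¹ * a⁻¹ * c * b) * c * (b⁻¹ * a⁻¹ * c * b)⁻¹) * (a * b)⁻¹ =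
      a * b * a * b * a * (c * b * c * b * c) := by
    have hb₂ (x : G) : b * (b * x) = x := by rw [← mul_assoc, ← sq, hb, one_mul]
    have ha₁ : a * a = 1 := by rw [← sq, ha]
    simp only [mul_inv_rev, ha', hb', hc', mul_assoc, hb₂, ha₁, mul_one]
  rw [← conj_eq_one_iff (a := a * b), hconj, mul_eq_one_iff_eq_inv, hinv]

/-- When `ababa = cbcbc`, the relator `b v c v⁻¹` with `v = c a b a b a` is `(c b) ^ 3`. -/
theorem mul_conj_eq_pow_three (ha : a ^ 2 = 1) (hb : b ^ 2 = 1) (hc : c ^ 2 = 1)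
    (h : a * b * a * b * a = c * b * c * b * c) :
    b * (c⁻¹ * a * b * a * b⁻¹ * a⁻¹) * c * (c⁻¹ * a * b * a * b⁻¹ * a⁻¹)⁻¹ = (c * b) ^ 3 := by
  have hb₂ (x : G) : b * (b * x) = x := by rw [← mul_assoc, ← sq, hb, one_mul]
  have hc₂ (x : G) : c * (c * x) = x := by rw [← mul_assoc, ← sq, hc, one_mul]
  have hv : c⁻¹ * a * b * a * b⁻¹ * a⁻¹ = b * c * b * c := by
    calc c⁻¹ * a * b * a * b⁻¹ * a⁻¹ = c⁻¹ * (a * b * a * b * a) := by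
          simp only [inv_eq_self_of_sq_eq_one ha, inv_eq_self_of_sq_eq_one hb, mul_assoc]
      _ = b * c * b * c := by rw [h]; group
  rw [hv]
  simp only [mul_inv_rev, inv_eq_self_of_sq_eq_one hb, inv_eq_self_of_sq_eq_one hc, mul_assoc,
    hb₂, hc₂, pow_succ, pow_zero, one_mul]

theorem mul_pow_three_eq_one_comm : (a * b) ^ 3 = 1 ↔ (b * a) ^ 3 = 1 := by
  rw [← conj_eq_one_iff (a := b), ← conj_pow,
    show b * (a * b) * b⁻¹ = b * a by group]

end

/-- The fundamental group of the Price twist `τ_{R(D(3₁#6₁#3₁*))}` is isomorphic to the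
Coxeter group `W(3,3,∞)`. -/
theorem stmt_10 : Nonempty (PresentedGroup rels10 ≃* PresentedGroup W33InfRels) := by
  apply PresentedGroup.nonempty_mulEquiv_of_mk_eq_one
  · have mem {r} (hr : r ∈ W33InfRels) := PresentedGroup.one_of_mem hr
    have ha := mem (r := x1 ^ 2) (by simp [W33InfRels])
    have hb := mem (r := x2 ^ 2) (by simp [W33InfRels])
    have hc := mem (r := x3 ^ 2) (by simp [W33InfRels])
    have hab := mem (r := (x1 * x2) ^ 3) (by simp [W33InfRels])
    have hbc := mem (r := (x2 * x3) ^ 3) (by simp [W33InfRels])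
    simp only [map_mul, map_pow] at ha hb hc hab hbc
    have hcb := mul_pow_three_eq_one_comm.1 hbc
    have h := ((mul_pow_three_eq_one_iff hb).1 hab).trans
      ((mul_pow_three_eq_one_iff hb).1 hcb).symm
    rintro r (rfl | rfl | rfl)
    · rwa [map_pow]
    · simpa only [u, map_mul, map_inv] using (conj_relation_iff ha hb hc).2 h
    · simpa only [v, map_mul, map_inv] using (mul_conj_eq_pow_three ha hb hc h).trans hcb
  · have mem {r} (hr : r ∈ rels10) := PresentedGroup.one_of_mem hr
    have ha := mem (r := x1 ^ 2) (by simp [rels10])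
    have hu := mem (r := x1 * u * x3 * u⁻¹) (by simp [rels10])
    have hv := mem (r := x2 * v * x3 * v⁻¹) (by simp [rels10])
    simp only [u, v, map_mul, map_inv, map_pow] at ha hu hv
    have hc := (sq_eq_one_iff_of_mul_conj_eq_one hu).1 ha
    have hb := (sq_eq_one_iff_of_mul_conj_eq_one hv).2 hc
    have h := (conj_relation_iff ha hb hc).1 hu
    have hcb := (mul_conj_eq_pow_three ha hb hc h).symm.trans hv
    have hab := (mul_pow_three_eq_one_iff hb).2
      (h.trans ((mul_pow_three_eq_one_iff hb).1 hcb))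
    rintro r (rfl | rfl | rfl | rfl | rfl)
    · rwa [map_pow]
    · rwa [map_pow]
    · rwa [map_pow]
    · rwa [map_pow, map_mul]
    · rwa [map_pow, map_mul, mul_pow_three_eq_one_comm]
end

section
/- For every natural number n, the presented group on three generators x₁, x₂, x₃ with relators x₁^2, x₂^2, x₃^2, (x₁*x₂)^2*((x₂*x₃)^3)⁻¹ and (x₁*x₃)^3 is not isomorphic to the dihedral group of order 2(2n+1) (Mathlib's DihedralGroup (2n+1)). -/
/-- The relators of the Coxeter-like presentation
`⟨x₁, x₂, x₃ ∣ x₁² = x₂² = x₃² = 1, (x₁x₂)² = (x₂x₃)³, (x₁x₃)³ = 1⟩`. -/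
def targetRels : Set (FreeGroup (Fin 3)) :=
  {x1 ^ 2, x2 ^ 2, x3 ^ 2, (x1 * x2) ^ 2 * ((x2 * x3) ^ 3)⁻¹, (x1 * x3) ^ 3}

theorem DihedralGroup.commute_sq_sq {m : ℕ} (g h : DihedralGroup m) :
    Commute (g ^ 2) (h ^ 2) := by
  rcases g with i | i <;> rcases h with j | j <;>
    simp [Commute, SemiconjBy, pow_two, DihedralGroup.r_mul_r, DihedralGroup.sr_mul_sr,
      add_comm]

/-- The images of `x₁, x₂, x₃` in the symmetric group on four letters: adjacent transpositions,
ordered so that the first two commute. -/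
def transpositionImage : Fin 3 → Equiv.Perm (Fin 4) :=
  ![Equiv.swap 0 1, Equiv.swap 2 3, Equiv.swap 1 2]

theorem lift_transpositionImage_eq_one :
    ∀ r ∈ targetRels, FreeGroup.lift transpositionImage r = 1 := by
  rintro r (rfl | rfl | rfl | rfl | rfl) <;>
    simp only [x1, x2, x3, map_mul, map_pow, map_inv, FreeGroup.lift_apply_of] <;> decide

/-- For every natural number `n`, the presented group
`⟨x₁, x₂, x₃ ∣ x₁² = x₂² = x₃² = 1, (x₁x₂)² = (x₂x₃)³, (x₁x₃)³ = 1⟩` is not isomorphic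
to the dihedral group `D_{2n+1}` of order `2(2n+1)`. -/
theorem stmt_16 (n : ℕ) :
    IsEmpty (PresentedGroup targetRels ≃* DihedralGroup (2 * n + 1)) := by
  refine ⟨fun e => ?_⟩
  let φ := PresentedGroup.toGroup lift_transpositionImage_eq_one
  let x : Fin 3 → PresentedGroup targetRels := PresentedGroup.of
  have h : Commute ((x 0 * x 2) ^ 2) ((x 1 * x 2) ^ 2) := by
    refine Commute.of_map e.injective ?_
    simpa only [map_pow] using DihedralGroup.commute_sq_sq (e (x 0 * x 2)) (e (x 1 * x 2))
  have hφ := (h.map φ).eq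
  simp only [map_pow, map_mul, φ, x, PresentedGroup.toGroup.of] at hφ
  revert hφ
  decide
end
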